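/- Let Ω ⊂ ℝ² be a nonempty open bounded connected domain such that H(Ω) = Cut(Ω) =: S. Then S is either a singleton or a 1-dimensional manifold of class C^{1,1} (possibly with boundary), and, setting ρ_Ω := max over the closure of Ω of d_{∂Ω}, one has Ω = {x ∈ ℝ² : d_S(x) < ρ_Ω}, i.e. Ω is the open ρ_Ω-tubular neighborhood of S. -/

import Mathlib

open Metric Set Real

noncomputable section

abbrev E2 := EuclideanSpace ℝ (Fin 2)

/-- The point of the Euclidean plane with coordinates `(a, b)`. -/
def pt (a b : ℝ) : E2 := (EuclideanSpace.equiv (Fin 2) ℝ).symm ![a, b]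

/-- The set of closest points to `x` on the boundary of `Ω`. -/
def projBd (Ω : Set E2) (x : E2) : Set E2 :=
  {y ∈ frontier Ω | dist x y = infDist x (frontier Ω)}

/-- The skeleton `Σ(Ω)`: points of `Ω` with more than one closest boundary point. -/
def skeleton (Ω : Set E2) : Set E2 :=
  {x ∈ Ω | ∃ y ∈ projBd Ω x, ∃ z ∈ projBd Ω x, y ≠ z}

/-- The cut locus `Cut(Ω)`: the closure of the skeleton (taken in `closure Ω`,
which agrees with the full closure since `Σ(Ω) ⊆ Ω`). -/
def cutLocus (Ω : Set E2) : Set E2 := closure (skeleton Ω)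

/-- The high ridge `H(Ω)`: the set where `d_{∂Ω}` attains its maximum over `closure Ω`. -/
def highRidge (Ω : Set E2) : Set E2 :=
  {x ∈ closure Ω | ∀ z ∈ closure Ω, infDist z (frontier Ω) ≤ infDist x (frontier Ω)}

/-- `ρ_Ω`, the maximum of `d_{∂Ω}` over `closure Ω`. -/
def inradius (Ω : Set E2) : ℝ :=
  sSup ((fun z => infDist z (frontier Ω)) '' closure Ω)

/-- `S` is, near `p`, in suitable orthonormal coordinates (i.e. up to a rigid motion `e`),
the graph of a `C¹` function with Lipschitz derivative over an interval `I`, which is either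
open or half-open. -/
def IsC11GraphAt (S : Set E2) (p : E2) : Prop :=
  ∃ (e : E2 ≃ᵃⁱ[ℝ] E2) (U : Set E2) (g : ℝ → ℝ) (I : Set ℝ),
    IsOpen U ∧ p ∈ U ∧
    ((∃ a b : ℝ, a < b ∧ I = Set.Ioo a b) ∨ (∃ a b : ℝ, a < b ∧ I = Set.Ico a b)) ∧
    ContDiff ℝ 1 g ∧ (∃ K : NNReal, LipschitzWith K (deriv g)) ∧
    e '' (S ∩ U) = (fun t => pt t (g t)) '' I


/-! ### The distance function from the boundary -/

theorem infDist_ascent {F : Set E2} (hF : IsCompact F) (hne : F.Nonempty) {x w : E2} {c : ℝ}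
    (hw : ‖w‖ = 1) (hx : 0 < infDist x F)
    (h : ∀ y ∈ F, dist x y = infDist x F → c * dist x y < inner ℝ (x - y) w) :
    ∃ η > 0, ∀ t, 0 < t → t < η → infDist x F + c * t < infDist (x + t • w) F := by
  have hK : IsCompact (F ∩ {y | inner ℝ (x - y) w ≤ c * dist x y}) :=
    hF.inter_right (isClosed_le (by fun_prop) (by fun_prop))
  have hgap : ∃ η > 0, ∀ y ∈ F ∩ {y | inner ℝ (x - y) w ≤ c * dist x y},
      infDist x F + 2 * η ≤ dist x y := by
    rcases (F ∩ {y | inner ℝ (x - y) w ≤ c * dist x y}).eq_empty_or_nonempty with he | hn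
    · exact ⟨1, one_pos, fun y hy => by simp [he] at hy⟩
    · obtain ⟨y₀, hy₀, hmin⟩ := hK.exists_isMinOn hn
        (f := fun y => dist x y) (by fun_prop)
      have hle : infDist x F ≤ dist x y₀ := infDist_le_dist_of_mem hy₀.1
      have hlt : infDist x F < dist x y₀ :=
        lt_of_le_of_ne hle fun he => absurd (h y₀ hy₀.1 he.symm) (not_lt.2 hy₀.2)
      refine ⟨(dist x y₀ - infDist x F) / 2, by linarith, fun y hy => ?_⟩
      have := hmin hy
      simp only [mem_ofPred_eq] at this
      linarith
  obtain ⟨η, hη, hgap⟩ := hgap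
  refine ⟨η, hη, fun t ht htη => ?_⟩
  obtain ⟨y, hyF, hy⟩ := hF.exists_infDist_eq_dist hne (x + t • w)
  have htw : dist x (x + t • w) = t := by simp [norm_smul, hw, abs_of_pos ht]
  have h1 : infDist (x + t • w) F ≤ infDist x F + t := by
    have := infDist_le_infDist_add_dist (s := F) (x := x + t • w) (y := x)
    rwa [dist_comm, htw] at this
  have h2 : dist x y ≤ t + infDist (x + t • w) F := by
    have := dist_triangle x (x + t • w) y
    rwa [htw, ← hy] at this
  have hyK : c * dist x y < inner ℝ (x - y) w := by
    by_contra hcon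
    have := hgap y ⟨hyF, not_lt.1 hcon⟩
    linarith
  have hD : infDist x F ≤ dist x y := infDist_le_dist_of_mem hyF
  have hcs : inner ℝ (x + t • w - y) (x - y) ≤ dist (x + t • w) y * dist x y := by
    rw [dist_eq_norm, dist_eq_norm]
    exact real_inner_le_norm _ _
  have hexp : inner ℝ (x + t • w - y) (x - y) = dist x y ^ 2 + t * inner ℝ (x - y) w := by
    rw [add_sub_right_comm, inner_add_left, real_inner_self_eq_norm_sq, dist_eq_norm,
      real_inner_smul_left, real_inner_comm]
  rw [hy]
  have hpos : 0 < dist x y := lt_of_lt_of_le hx hD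
  have : (dist x y + c * t) * dist x y < dist (x + t • w) y * dist x y := by
    nlinarith [mul_lt_mul_of_pos_left hyK ht]
  have := lt_of_mul_lt_mul_right this hpos.le
  linarith

section Domain

variable {Ω : Set E2}

theorem frontier_nonempty (hne : Ω.Nonempty) (hbd : Bornology.IsBounded Ω) :
    (frontier Ω).Nonempty :=
  nonempty_frontier_iff.2 ⟨hne, fun h => NormedSpace.unbounded_univ ℝ E2 (h ▸ hbd)⟩

theorem isCompact_frontier_of_isBounded (hbd : Bornology.IsBounded Ω) :
    IsCompact (frontier Ω) :=
  hbd.isCompact_closure.of_isClosed_subset isClosed_frontier frontier_subset_closure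

theorem infDist_frontier_pos (hne : Ω.Nonempty) (hop : IsOpen Ω) (hbd : Bornology.IsBounded Ω)
    {x : E2} (hx : x ∈ Ω) : 0 < infDist x (frontier Ω) :=
  (isClosed_frontier.notMem_iff_infDist_pos (frontier_nonempty hne hbd)).1 fun h =>
    (hop.frontier_eq ▸ h).2 hx

theorem mem_of_infDist_frontier_pos (hop : IsOpen Ω) {x : E2} (hx : x ∈ closure Ω)
    (hpos : 0 < infDist x (frontier Ω)) : x ∈ Ω := by
  by_contra h
  have : x ∈ frontier Ω := hop.frontier_eq ▸ ⟨hx, h⟩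
  rw [infDist_zero_of_mem this] at hpos
  exact lt_irrefl _ hpos

theorem ball_infDist_frontier_subset (hop : IsOpen Ω) {x : E2} (hx : x ∈ Ω)
    (hpos : 0 < infDist x (frontier Ω)) : ball x (infDist x (frontier Ω)) ⊆ Ω := by
  refine (convex_ball x _).isPreconnected.subset_left_of_subset_union hop
    isClosed_closure.isOpen_compl (disjoint_compl_right.mono_left subset_closure) ?_
    ⟨x, mem_ball_self hpos, hx⟩
  intro y hy
  by_contra hcon
  simp only [mem_union, mem_compl_iff, not_or, not_not] at hcon
  have : y ∈ frontier Ω := hop.frontier_eq ▸ ⟨hcon.2, hcon.1⟩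
  have h2 := infDist_le_dist_of_mem (x := x) this
  rw [mem_ball, dist_comm] at hy
  linarith

theorem exists_isMaxOn_infDist_frontier (hne : Ω.Nonempty) (hbd : Bornology.IsBounded Ω) :
    ∃ z ∈ closure Ω, infDist z (frontier Ω) = inradius Ω ∧
      ∀ x ∈ closure Ω, infDist x (frontier Ω) ≤ inradius Ω := by
  obtain ⟨z, hz, hmax⟩ := hbd.isCompact_closure.exists_isMaxOn hne.closure
    (f := fun z => infDist z (frontier Ω)) (continuous_infDist_pt _).continuousOn
  have hgr : IsGreatest ((fun z => infDist z (frontier Ω)) '' closure Ω)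
      (infDist z (frontier Ω)) := by
    refine ⟨mem_image_of_mem _ hz, ?_⟩
    rintro _ ⟨x, hx, rfl⟩
    exact hmax hx
  have h : inradius Ω = infDist z (frontier Ω) := hgr.csSup_eq
  exact ⟨z, hz, h.symm, fun x hx => h ▸ hmax hx⟩

theorem mem_highRidge_iff (hne : Ω.Nonempty) (hbd : Bornology.IsBounded Ω) {x : E2} :
    x ∈ highRidge Ω ↔ x ∈ closure Ω ∧ infDist x (frontier Ω) = inradius Ω := by
  obtain ⟨z, hz, hzr, hmax⟩ := exists_isMaxOn_infDist_frontier hne hbd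
  constructor
  · rintro ⟨hx, h⟩
    exact ⟨hx, le_antisymm (hmax x hx) (hzr ▸ h z hz)⟩
  · rintro ⟨hx, h⟩
    exact ⟨hx, fun y hy => h ▸ hmax y hy⟩

theorem inradius_pos (hne : Ω.Nonempty) (hop : IsOpen Ω) (hbd : Bornology.IsBounded Ω) :
    0 < inradius Ω := by
  obtain ⟨x, hx⟩ := hne
  obtain ⟨z, hz, hzr, hmax⟩ := exists_isMaxOn_infDist_frontier ⟨x, hx⟩ hbd
  exact (infDist_frontier_pos ⟨x, hx⟩ hop hbd hx).trans_le (hmax x (subset_closure hx))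

theorem highRidge_nonempty (hne : Ω.Nonempty) (hbd : Bornology.IsBounded Ω) :
    (highRidge Ω).Nonempty := by
  obtain ⟨z, hz, hzr, -⟩ := exists_isMaxOn_infDist_frontier hne hbd
  exact ⟨z, (mem_highRidge_iff hne hbd).2 ⟨hz, hzr⟩⟩

theorem isCompact_highRidge (hne : Ω.Nonempty) (hbd : Bornology.IsBounded Ω) :
    IsCompact (highRidge Ω) := by
  have : highRidge Ω = closure Ω ∩ {x | infDist x (frontier Ω) = inradius Ω} :=
    Set.ext fun x => mem_highRidge_iff hne hbd
  rw [this]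
  exact hbd.isCompact_closure.inter_right
    (isClosed_eq (continuous_infDist_pt _) continuous_const)

theorem highRidge_subset (hne : Ω.Nonempty) (hop : IsOpen Ω) (hbd : Bornology.IsBounded Ω) :
    highRidge Ω ⊆ Ω := fun x hx => by
  obtain ⟨h1, h2⟩ := (mem_highRidge_iff hne hbd).1 hx
  exact mem_of_infDist_frontier_pos hop h1 (h2 ▸ inradius_pos hne hop hbd)

theorem infDist_highRidge_le (hne : Ω.Nonempty) (hop : IsOpen Ω) (hbd : Bornology.IsBounded Ω)
    (hsk : skeleton Ω ⊆ highRidge Ω) {x : E2} (hx : x ∈ Ω) :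
    infDist x (highRidge Ω) ≤ inradius Ω - infDist x (frontier Ω) := by
  have hF := isCompact_frontier_of_isBounded hbd
  have hFne := frontier_nonempty hne hbd
  have hdx := infDist_frontier_pos hne hop hbd hx
  have key : ∀ c : ℝ, 0 < c → c < 1 →
      c * infDist x (highRidge Ω) ≤ inradius Ω - infDist x (frontier Ω) := by
    intro c hc0 hc1
    obtain ⟨z, hz, hmax⟩ := hbd.isCompact_closure.exists_isMaxOn hne.closure
      (f := fun z => infDist z (frontier Ω) - c * dist z x)
      ((continuous_infDist_pt _).sub (by fun_prop)).continuousOn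
    have hxz := hmax (subset_closure hx)
    simp only [mem_ofPred_eq, dist_self, mul_zero, sub_zero] at hxz
    have hdz : 0 < infDist z (frontier Ω) := by
      have := mul_nonneg hc0.le (dist_nonneg (x := z) (y := x))
      linarith
    have hzΩ := mem_of_infDist_frontier_pos hop hz hdz
    have hzH : z ∈ highRidge Ω := by
      by_contra hzH
      obtain ⟨y, hyF, hy⟩ := hF.exists_infDist_eq_dist hFne z
      have huniq : ∀ y' ∈ frontier Ω, dist z y' = infDist z (frontier Ω) → y' = y := by
        intro y' hy' hd
        by_contra hne'
        exact hzH (hsk ⟨hzΩ, y', ⟨hy', hd⟩, y, ⟨hyF, hy.symm⟩, hne'⟩)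
      have hzy : 0 < ‖z - y‖ := by rw [← dist_eq_norm, ← hy]; exact hdz
      have hw : ‖(‖z - y‖⁻¹ • (z - y))‖ = 1 := by
        rw [norm_smul, norm_inv, norm_norm, inv_mul_cancel₀ hzy.ne']
      obtain ⟨η, hη, hasc⟩ := infDist_ascent hF hFne (c := c) hw hdz (by
        intro y' hy' hd
        rw [huniq y' hy' hd, real_inner_smul_right, real_inner_self_eq_norm_sq, dist_eq_norm]
        have : ‖z - y‖⁻¹ * ‖z - y‖ ^ 2 = ‖z - y‖ := by field_simp
        rw [this]
        nlinarith)
      obtain ⟨ε, hε, hball⟩ := Metric.isOpen_iff.1 hop z hzΩ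
      have ht : 0 < min η ε / 2 := by positivity
      have htη : min η ε / 2 < η := by have := min_le_left η ε; linarith
      have htε : min η ε / 2 < ε := by have := min_le_right η ε; linarith
      generalize min η ε / 2 = t at ht htη htε
      generalize ‖z - y‖⁻¹ • (z - y) = w at hw hasc
      have h1 := hasc t ht htη
      have hd : dist (z + t • w) z = t := by simp [norm_smul, hw, abs_of_pos ht]
      have h2 := hmax (subset_closure (hball (by rwa [mem_ball, hd])))
      simp only [mem_ofPred_eq] at h2
      have h3 := dist_triangle (z + t • w) z x
      rw [hd] at h3
      nlinarith [mul_le_mul_of_nonneg_left h3 hc0.le]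
    have h1 := infDist_le_dist_of_mem (x := x) hzH
    rw [((mem_highRidge_iff hne hbd).1 hzH).2] at hxz
    rw [dist_comm] at h1
    nlinarith [mul_le_mul_of_nonneg_left h1 hc0.le]
  refine le_of_forall_pos_le_add fun ε hε => ?_
  have hD := infDist_nonneg (x := x) (s := highRidge Ω)
  set D := infDist x (highRidge Ω)
  have hc := key (1 - ε / (ε + D + 1))
    (by rw [sub_pos, div_lt_one (by positivity)]; linarith) (by
      have : 0 < ε / (ε + D + 1) := by positivity
      linarith)
  have : ε / (ε + D + 1) * D ≤ ε := by
    rw [div_mul_eq_mul_div, div_le_iff₀ (by positivity)]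
    nlinarith
  linarith

theorem eq_tubularNeighborhood (hne : Ω.Nonempty) (hop : IsOpen Ω)
    (hbd : Bornology.IsBounded Ω) (hsk : skeleton Ω ⊆ highRidge Ω) :
    Ω = {x | infDist x (highRidge Ω) < inradius Ω} := by
  ext x
  constructor
  · intro hx
    have h1 := infDist_highRidge_le hne hop hbd hsk hx
    have h2 := infDist_frontier_pos hne hop hbd hx
    simp only [mem_ofPred_eq]
    linarith
  · intro hx
    obtain ⟨s, hs, hxs⟩ := (infDist_lt_iff (highRidge_nonempty hne hbd)).1 hx
    have h := ((mem_highRidge_iff hne hbd).1 hs).2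
    refine ball_infDist_frontier_subset hop (highRidge_subset hne hop hbd hs)
      (h ▸ inradius_pos hne hop hbd) ?_
    rwa [h, mem_ball]

theorem isPreconnected_highRidge (hop : IsOpen Ω) (hbd : Bornology.IsBounded Ω)
    (hconn : IsConnected Ω) (hsk : skeleton Ω ⊆ highRidge Ω) :
    IsPreconnected (highRidge Ω) := by
  have hne := hconn.nonempty
  have hF := isCompact_frontier_of_isBounded hbd
  have hFne := frontier_nonempty hne hbd
  have hH := isCompact_highRidge hne hbd
  rw [isPreconnected_closed_iff]
  rintro A B hA hB hAB ⟨a₀, ha₀⟩ ⟨b₀, hb₀⟩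
  set H := highRidge Ω
  have hcA := hH.inter_right hA
  have hcB := hH.inter_right hB
  have hsub : H ⊆ Ω := highRidge_subset hne hop hbd
  have hcont : ContinuousOn (fun x => infDist x (H ∩ A) - infDist x (H ∩ B)) Ω :=
    ((continuous_infDist_pt _).sub (continuous_infDist_pt _)).continuousOn
  obtain ⟨x, hx, hx0⟩ := hconn.isPreconnected.intermediate_value (hsub ha₀.1) (hsub hb₀.1) hcont
    (show (0 : ℝ) ∈ _ from ⟨by
      simp only [infDist_zero_of_mem ha₀, zero_sub, neg_nonpos]; exact infDist_nonneg, by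
      simp only [infDist_zero_of_mem hb₀, sub_zero]; exact infDist_nonneg⟩)
  obtain ⟨a, ha, hxa⟩ := hcA.exists_infDist_eq_dist ⟨a₀, ha₀⟩ x
  obtain ⟨b, hb, hxb⟩ := hcB.exists_infDist_eq_dist ⟨b₀, hb₀⟩ x
  obtain ⟨s, hs, hxs⟩ := hH.exists_infDist_eq_dist (highRidge_nonempty hne hbd) x
  obtain ⟨y, hy, hxy⟩ := hF.exists_infDist_eq_dist hFne x
  have hle := infDist_highRidge_le hne hop hbd hsk hx
  have hab : dist x a = dist x b := by simp only at hx0; linarith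
  have hxa' : dist x a ≤ dist x s := by
    rcases hAB hs with h | h
    · exact hxa ▸ infDist_le_dist_of_mem ⟨hs, h⟩
    · exact hab ▸ hxb ▸ infDist_le_dist_of_mem ⟨hs, h⟩
  have ray : ∀ u ∈ H, dist x u = dist x a → ‖u - x‖ • (x - y) = ‖x - y‖ • (u - x) := by
    intro u hu hua
    refine SameRay.norm_smul_eq (sameRay_iff_norm_add.2 (le_antisymm (norm_add_le _ _) ?_))
    have h1 : inradius Ω ≤ dist u y := by
      rw [← ((mem_highRidge_iff hne hbd).1 hu).2]
      exact infDist_le_dist_of_mem hy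
    rw [sub_add_sub_cancel, ← dist_eq_norm, ← dist_eq_norm, ← dist_eq_norm, dist_comm u x, hua]
    change infDist x H ≤ _ at hle
    linarith
  have hxy0 : ‖x - y‖ ≠ 0 := by
    rw [← dist_eq_norm, ← hxy]
    exact (infDist_frontier_pos hne hop hbd hx).ne'
  have h1 := ray a ha.1 rfl
  have h2 := ray b hb.1 hab.symm
  rw [← dist_eq_norm, dist_comm, hab, dist_comm, dist_eq_norm, h2] at h1
  have : b - x = a - x := smul_right_injective E2 hxy0 h1
  have hba : b = a := sub_left_injective this
  exact ⟨a, ha.1, ha.2, hba ▸ hb.2⟩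

end Domain

/-! ### Two-sided tangent balls -/

/-- At every point of `S` there is a direction `ν` such that `S` lies outside the two balls of
radius `1 / (2 * K)` which touch the point in the directions `ν` and `-ν`. -/
def HasTangentBalls (K : ℝ) (S : Set E2) : Prop :=
  ∀ s ∈ S, ∃ ν : E2, ‖ν‖ = 1 ∧ ∀ s' ∈ S, |inner ℝ (s' - s) ν| ≤ K * ‖s' - s‖ ^ 2

theorem inner_eq (x y : E2) : inner ℝ x y = x 0 * y 0 + x 1 * y 1 := by
  simp [PiLp.inner_apply, Fin.sum_univ_two, mul_comm]

theorem norm_sq_eq (x : E2) : ‖x‖ ^ 2 = x 0 ^ 2 + x 1 ^ 2 := by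
  rw [EuclideanSpace.real_norm_sq_eq, Fin.sum_univ_two]

@[simp] theorem pt_zero (a b : ℝ) : pt a b 0 = a := by simp [pt]

@[simp] theorem pt_one (a b : ℝ) : pt a b 1 = b := by simp [pt]

theorem ext_coords {x y : E2} (h0 : x 0 = y 0) (h1 : x 1 = y 1) : x = y := by
  ext i; fin_cases i <;> assumption

theorem exists_tangent_direction {H N : Set E2} {s : E2} (hs : AccPt s (Filter.principal H))
    (hN : ∀ ν ∈ N, ∀ s' ∈ H, 2 * inner ℝ (s' - s) ν ≤ ‖s' - s‖ ^ 2) :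
    ∃ w : E2, ‖w‖ = 1 ∧ ∀ ν ∈ N, inner ℝ ν w ≤ 0 := by
  have h1 : ∀ n : ℕ, ∃ y ∈ ball s (1 / ((n : ℝ) + 1)) ∩ H, y ≠ s := fun n =>
    accPt_iff_nhds.1 hs _ (ball_mem_nhds _ (by positivity))
  choose y hy hys using h1
  have hpos : ∀ n, 0 < ‖y n - s‖ := fun n => norm_pos_iff.2 (sub_ne_zero.2 (hys n))
  have hmem : ∀ n, ‖y n - s‖⁻¹ • (y n - s) ∈ sphere (0 : E2) 1 := fun n => by
    rw [mem_sphere_zero_iff_norm, norm_smul, norm_inv, norm_norm, inv_mul_cancel₀ (hpos n).ne']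
  obtain ⟨w, hw, φ, hφ, hlim⟩ := (isCompact_sphere (0 : E2) 1).tendsto_subseq hmem
  refine ⟨w, mem_sphere_zero_iff_norm.1 hw, fun ν hν => ?_⟩
  have hl : Filter.Tendsto (fun n => inner ℝ ν (‖y (φ n) - s‖⁻¹ • (y (φ n) - s))) Filter.atTop
      (nhds (inner ℝ ν w)) := tendsto_const_nhds.inner hlim
  have hz : Filter.Tendsto (fun n : ℕ => 1 / ((φ n : ℝ) + 1)) Filter.atTop (nhds 0) :=
    tendsto_one_div_add_atTop_nhds_zero_nat.comp hφ.tendsto_atTop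
  refine le_of_tendsto_of_tendsto' hl hz fun n => ?_
  have h2 := hN ν hν _ (hy (φ n)).2
  have h3 : ‖y (φ n) - s‖ < 1 / ((φ n : ℝ) + 1) := by
    have := (hy (φ n)).1
    rwa [mem_ball, dist_eq_norm] at this
  refine le_trans ?_ h3.le
  rw [real_inner_smul_right, real_inner_comm, inv_mul_le_iff₀ (hpos _)]
  nlinarith [hpos (φ n)]

theorem exists_normal_of_tangent {N : Set E2} (hN : IsCompact N) {ρ : ℝ} {w n : E2}
    (hn : n ≠ 0) (hbd : ∀ ν ∈ N, inner ℝ ν n ≤ ρ) (hw : ∀ ν ∈ N, inner ℝ ν w ≤ 0)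
    (hwn : ∀ t : ℝ, w + t • n ≠ 0)
    (hcrit : ∀ u : E2, u ≠ 0 → ∃ ν ∈ N, 0 ≤ inner ℝ ν u) :
    ∃ ν ∈ N, inner ℝ ν w = 0 ∧ 0 ≤ inner ℝ ν n := by
  have hN' : IsCompact (N ∩ {ν | 0 ≤ inner ℝ ν n}) :=
    hN.inter_right (isClosed_le (by fun_prop) (by fun_prop))
  obtain ⟨ν₀, hν₀, hmax⟩ := hN'.exists_isMaxOn (hcrit n hn) (f := fun ν => inner ℝ ν w)
    (by fun_prop)
  refine ⟨ν₀, hν₀.1, le_antisymm (hw _ hν₀.1) ?_, hν₀.2⟩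
  by_contra! hneg
  have hρ : 0 ≤ ρ := le_trans hν₀.2 (hbd _ hν₀.1)
  set δ := -inner ℝ ν₀ w with hδ
  have hδpos : 0 < δ := by linarith
  have ht : 0 < δ / (2 * ρ + 1) := by positivity
  obtain ⟨ν, hν, hge⟩ := hcrit (w + (δ / (2 * ρ + 1)) • n) (hwn _)
  rw [inner_add_right, real_inner_smul_right] at hge
  have h1 := hw ν hν
  have h2 : 0 ≤ inner ℝ ν n := by
    by_contra! h
    nlinarith [mul_neg_of_pos_of_neg ht h]
  have h3 := hmax (show ν ∈ N ∩ _ from ⟨hν, h2⟩)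
  simp only [mem_ofPred_eq] at h3
  have h4 := mul_le_mul_of_nonneg_left (hbd ν hν) ht.le
  have h5 : δ / (2 * ρ + 1) * ρ < δ := by
    rw [div_mul_eq_mul_div, div_lt_iff₀ (by positivity)]
    nlinarith
  linarith

theorem hasTangentBalls_highRidge {Ω : Set E2} (hop : IsOpen Ω) (hbd : Bornology.IsBounded Ω)
    (hconn : IsConnected Ω) (hsk : skeleton Ω ⊆ highRidge Ω) (hnt : (highRidge Ω).Nontrivial) :
    HasTangentBalls (1 / (2 * inradius Ω)) (highRidge Ω) := by
  have hne := hconn.nonempty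
  have hF := isCompact_frontier_of_isBounded hbd
  have hFne := frontier_nonempty hne hbd
  have hρ := inradius_pos hne hop hbd
  have hpre := isPreconnected_highRidge hop hbd hconn hsk
  intro s hs
  have hsρ := ((mem_highRidge_iff hne hbd).1 hs).2
  set ρ := inradius Ω
  set N : Set E2 := {ν | s + ν ∈ frontier Ω ∧ ‖ν‖ = ρ}
  have hNc : IsCompact N := by
    refine (isCompact_closedBall (0 : E2) ρ).of_isClosed_subset
      ((isClosed_frontier.preimage (by fun_prop)).inter
        (isClosed_eq continuous_norm continuous_const)) fun ν hν => ?_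
    rw [mem_closedBall_zero_iff]
    exact hν.2.le
  have hNS : ∀ ν ∈ N, ∀ s' ∈ highRidge Ω, 2 * inner ℝ (s' - s) ν ≤ ‖s' - s‖ ^ 2 := by
    intro ν hν s' hs'
    have h1 : ρ ≤ ‖s' - s - ν‖ := by
      have h0 : infDist s' (frontier Ω) = ρ := ((mem_highRidge_iff hne hbd).1 hs').2
      rw [← h0, sub_sub, ← dist_eq_norm]
      exact infDist_le_dist_of_mem hν.1
    have h2 := norm_sub_sq_real (s' - s) ν
    rw [hν.2] at h2
    nlinarith
  obtain ⟨w, hw, hNw⟩ := exists_tangent_direction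
    (hpre.preperfect_of_nontrivial hnt s hs) hNS
  have hcrit : ∀ u : E2, u ≠ 0 → ∃ ν ∈ N, 0 ≤ inner ℝ ν u := by
    intro u hu
    by_contra! hcon
    have hu' : 0 < ‖u‖ := norm_pos_iff.2 hu
    have hu1 : ‖(‖u‖⁻¹ • u)‖ = 1 := by
      rw [norm_smul, norm_inv, norm_norm, inv_mul_cancel₀ hu'.ne']
    obtain ⟨η, hη, hasc⟩ := infDist_ascent hF hFne (c := 0) (x := s) hu1 (hsρ ▸ hρ) (by
      intro y hy hd
      have h1 := hcon (y - s) ⟨by rwa [add_sub_cancel], by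
        rw [← dist_eq_norm, dist_comm, hd, hsρ]⟩
      rw [real_inner_smul_right, zero_mul, ← neg_sub, inner_neg_left]
      exact mul_pos (inv_pos.2 hu') (neg_pos.2 h1))
    obtain ⟨z, -, -, hmax⟩ := exists_isMaxOn_infDist_frontier hne hbd
    obtain ⟨ε, hε, hball⟩ := Metric.isOpen_iff.1 hop s (highRidge_subset hne hop hbd hs)
    have ht : 0 < min η ε / 2 := by positivity
    have htη : min η ε / 2 < η := by have := min_le_left η ε; linarith
    have htε : min η ε / 2 < ε := by have := min_le_right η ε; linarith
    generalize min η ε / 2 = t at ht htη htε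
    generalize ‖u‖⁻¹ • u = v at hu1 hasc
    have h1 := hasc t ht htη
    have h2 := hmax _ (subset_closure (hball (show s + t • v ∈ ball s ε by
      rw [mem_ball, dist_eq_norm, add_sub_cancel_left, norm_smul, hu1, norm_eq_abs,
        abs_of_pos ht, mul_one]
      exact htε)))
    linarith
  have hw2 : w 0 ^ 2 + w 1 ^ 2 = 1 := by rw [← norm_sq_eq, hw]; norm_num
  have side : ∀ σ : ℝ, σ ^ 2 = 1 → (σ * ρ) • pt (-(w 1)) (w 0) ∈ N := by
    intro σ hσ
    have hnn : ‖σ • pt (-(w 1)) (w 0)‖ ^ 2 = 1 := by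
      rw [norm_sq_eq]
      simp only [PiLp.smul_apply, pt_zero, pt_one, smul_eq_mul]
      linear_combination hw2 + (w 0 ^ 2 + w 1 ^ 2) * hσ
    have hn1 : ‖σ • pt (-(w 1)) (w 0)‖ = 1 := by
      nlinarith [norm_nonneg (σ • pt (-(w 1)) (w 0))]
    obtain ⟨ν, hν, h1, h2⟩ := exists_normal_of_tangent hNc (ρ := ρ) (w := w)
      (n := σ • pt (-(w 1)) (w 0)) (by rw [← norm_pos_iff, hn1]; exact one_pos)
      (fun ν hν => by
        have := real_inner_le_norm ν (σ • pt (-(w 1)) (w 0))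
        rwa [hn1, hν.2, mul_one] at this)
      hNw (fun t h0 => by
        have : inner ℝ (w + t • σ • pt (-(w 1)) (w 0)) w = 1 := by
          rw [inner_eq]
          simp only [PiLp.add_apply, PiLp.smul_apply, pt_zero, pt_one, smul_eq_mul]
          linear_combination hw2
        rw [h0, inner_zero_left] at this
        exact zero_ne_one this) hcrit
    have hν2 : ν 0 ^ 2 + ν 1 ^ 2 = ρ ^ 2 := by rw [← norm_sq_eq, hν.2]
    rw [inner_eq] at h1 h2
    simp only [PiLp.smul_apply, pt_zero, pt_one, smul_eq_mul] at h2
    have h3 : ν 0 * (σ * -(w 1)) + ν 1 * (σ * w 0) = ρ := by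
      refine (pow_left_inj₀ h2 hρ.le two_ne_zero).1 ?_
      have h4 : (ν 0 * (σ * -(w 1)) + ν 1 * (σ * w 0)) ^ 2
          = σ ^ 2 * ((ν 0 ^ 2 + ν 1 ^ 2) * (w 0 ^ 2 + w 1 ^ 2) - (ν 0 * w 0 + ν 1 * w 1) ^ 2) := by
        ring
      rw [h4, h1, hν2, hw2, hσ]
      ring
    have : (σ * ρ) • pt (-(w 1)) (w 0) = ν := by
      refine ext_coords ?_ ?_
      · simp only [PiLp.smul_apply, pt_zero, smul_eq_mul]
        linear_combination σ * w 1 * h3 + ν 0 * hw2 - w 0 * h1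
          + (ν 0 * w 1 ^ 2 - ν 1 * w 0 * w 1) * hσ
      · simp only [PiLp.smul_apply, pt_one, smul_eq_mul]
        linear_combination -σ * w 0 * h3 + ν 1 * hw2 - w 1 * h1
          + (ν 1 * w 0 ^ 2 - ν 0 * w 0 * w 1) * hσ
    rwa [this]
  have hp := side 1 (by norm_num)
  have hm := side (-1) (by norm_num)
  refine ⟨pt (-(w 1)) (w 0), ?_, fun s' hs' => ?_⟩
  · have h1 := hp.2
    rw [one_mul, norm_smul, norm_eq_abs, abs_of_pos hρ] at h1
    exact mul_left_cancel₀ hρ.ne' (h1.trans (mul_one ρ).symm)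
  · have h1 := hNS _ hp s' hs'
    have h2 := hNS _ hm s' hs'
    rw [real_inner_smul_right] at h1 h2
    rw [div_mul_eq_mul_div, one_mul, le_div_iff₀ (by positivity), ← abs_of_pos
      (show 0 < 2 * ρ by positivity), ← abs_mul, abs_le]
    constructor <;> linarith

/-! ### Sets with two-sided tangent balls are locally graphs -/

theorem exists_contDiff_of_quadratic_approx {I : Set ℝ} (hI : Convex ℝ I) {f m : ℝ → ℝ} {C : ℝ}
    (hC : 0 ≤ C)
    (h : ∀ t ∈ I, ∀ t' ∈ I, |f t' - f t - m t * (t' - t)| ≤ C * (t' - t) ^ 2) :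
    ∃ g : ℝ → ℝ, ContDiff ℝ 1 g ∧ (∃ K : NNReal, LipschitzWith K (deriv g)) ∧ EqOn f g I := by
  have hm : LipschitzOnWith (2 * C).toNNReal m I := by
    refine LipschitzOnWith.of_dist_le_mul fun t ht t' ht' => ?_
    rw [dist_eq, dist_eq, Real.coe_toNNReal _ (by positivity)]
    rcases eq_or_ne t t' with rfl | hne
    · simp
    have h1 := h t ht t' ht'
    have h2 := h t' ht' t ht
    have hpos : 0 < |t - t'| := abs_pos.2 (sub_ne_zero.2 hne)
    have h3 : |m t - m t'| * |t - t'| ≤ 2 * C * |t - t'| * |t - t'| := by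
      rw [← abs_mul, mul_assoc (2 * C), abs_mul_abs_self]
      rw [abs_le] at h1 h2 ⊢
      constructor <;> nlinarith
    exact le_of_mul_le_mul_right h3 hpos
  obtain ⟨M, hM, hmM⟩ := hm.extend_real
  have hder : ∀ t, HasDerivAt (fun u => ∫ x in (0 : ℝ)..u, M x) (M t) t := fun t =>
    (hM.continuous.integral_hasStrictDerivAt 0 t).hasDerivAt
  rcases I.eq_empty_or_nonempty with rfl | ⟨t₀, ht₀⟩
  · exact ⟨0, contDiff_const, ⟨0, by simp [Pi.zero_def]⟩,
      eqOn_empty _ _⟩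
  set G : ℝ → ℝ := fun t => (∫ x in (0 : ℝ)..t, M x) + (f t₀ - ∫ x in (0 : ℝ)..t₀, M x) with hG
  have hGder : ∀ t, HasDerivAt G (M t) t := fun t => (hder t).add_const _
  have hGd : deriv G = M := funext fun t => (hGder t).deriv
  refine ⟨G, contDiff_one_iff_deriv.2 ⟨fun t => (hGder t).differentiableAt, ?_⟩, ⟨_, hGd ▸ hM⟩,
    fun t ht => ?_⟩
  · rw [hGd]
    exact hM.continuous
  · have hfder : ∀ t ∈ I, HasDerivWithinAt f (M t) I t := by
      intro t ht
      rw [hasDerivWithinAt_iff_isLittleO]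
      have hO : (fun t' => f t' - f t - (t' - t) • M t) =O[nhdsWithin t I]
          fun t' => (t' - t) ^ 2 := by
        refine Asymptotics.IsBigO.of_bound C ?_
        filter_upwards [self_mem_nhdsWithin] with t' ht'
        rw [norm_eq_abs, norm_eq_abs, abs_of_nonneg (sq_nonneg (t' - t)), smul_eq_mul, mul_comm,
          ← hmM ht]
        exact h t ht t' ht'
      refine hO.trans_isLittleO (Asymptotics.IsLittleO.mono ?_ nhdsWithin_le_nhds)
      have := Asymptotics.isLittleO_pow_sub_sub t (one_lt_two)
      simpa using this
    have hdiff := Convex.norm_image_sub_le_of_norm_hasDerivWithin_le (f := f - G)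
      (f' := fun _ => 0) (C := 0)
      (fun t ht => by simpa using (hfder t ht).sub (hGder t).hasDerivWithinAt)
      (fun t _ => by simp) hI ht₀ ht
    have h0 : f t₀ - G t₀ = 0 := by simp [hG]
    rw [Pi.sub_apply, Pi.sub_apply, h0, sub_zero, zero_mul, norm_le_zero_iff] at hdiff
    exact sub_eq_zero.1 hdiff

theorem inter_Ioo_eq_of_oneSided {T : Set ℝ} {c : ℝ} (hc : 0 < c) (h0 : Ico 0 c ⊆ T)
    (h : ∀ t ∈ T, |t| < c → Ico t c ⊆ T ∨ Ioc (-c) t ⊆ T) :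
    ∃ a < 0, T ∩ Ioo a c = Ioo a c ∨ T ∩ Ioo a c = Ico 0 c := by
  by_cases h1 : ∃ a < 0, ∀ t ∈ T, a < t → 0 ≤ t
  · obtain ⟨a, ha, hT⟩ := h1
    refine ⟨a, ha, Or.inr (Set.ext fun t => ⟨fun ht => ⟨hT t ht.1 ht.2.1, ht.2.2⟩, fun ht => ?_⟩)⟩
    exact ⟨h0 ht, ha.trans_le ht.1, ht.2⟩
  push Not at h1
  by_cases h2 : ∃ t ∈ T, -c < t ∧ t < 0 ∧ Ico t c ⊆ T
  · obtain ⟨t, -, -, ht0, ht⟩ := h2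
    exact ⟨t, ht0, Or.inl (inter_eq_right.2 (Ioo_subset_Ico_self.trans ht))⟩
  push Not at h2
  refine ⟨-c, neg_lt_zero.2 hc, Or.inl (inter_eq_right.2 fun t ht => ?_)⟩
  rcases le_or_gt 0 t with ht0 | ht0
  · exact h0 ⟨ht0, ht.2⟩
  obtain ⟨u, huT, htu, hu0⟩ := h1 t ht0
  have huc : -c < u := ht.1.trans htu
  rcases h u huT (abs_lt.2 ⟨huc, hu0.trans hc⟩) with h3 | h3
  · exact absurd h3 (h2 u huT huc hu0)
  · exact h3 ⟨ht.1, htu.le⟩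

theorem slope_estimate {K r n₀ n₁ dx dy : ℝ} (hK : 0 ≤ K) (hr : 40 * (K * r) ≤ 1)
    (hn : n₀ ^ 2 + n₁ ^ 2 = 1) (hn₀ : |n₀| ≤ 1 / 10) (hx : |dx| ≤ 2 * r) (hy : |dy| ≤ 2 * r)
    (h : |dx * n₀ + dy * n₁| ≤ K * (dx ^ 2 + dy ^ 2)) :
    |dy| ≤ |dx| / 2 ∧ |dy - -n₀ / n₁ * dx| ≤ 2 * K * dx ^ 2 := by
  have hn₁ : 9 / 10 ≤ |n₁| := by
    have h1 : n₀ ^ 2 ≤ (1 / 10) ^ 2 := sq_le_sq' (abs_le.1 hn₀).1 (abs_le.1 hn₀).2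
    rw [← sq_abs n₁] at hn
    nlinarith [abs_nonneg n₁]
  have hn₁0 : n₁ ≠ 0 := by
    rintro rfl
    norm_num at hn₁
  have h1 : |dy| * |n₁| ≤ |dx| * |n₀| + K * (dx ^ 2 + dy ^ 2) := by
    rw [← abs_mul, ← abs_mul]
    have := abs_sub (dx * n₀ + dy * n₁) (dx * n₀)
    rw [add_sub_cancel_left] at this
    linarith
  have h2 : K * dx ^ 2 ≤ |dx| / 20 := by
    rw [← sq_abs]
    nlinarith [abs_nonneg dx, mul_le_mul_of_nonneg_left hx hK]
  have h3 : K * dy ^ 2 ≤ |dy| / 20 := by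
    rw [← sq_abs]
    nlinarith [abs_nonneg dy, mul_le_mul_of_nonneg_left hy hK]
  have h4 : |dy| ≤ |dx| / 2 := by
    nlinarith [abs_nonneg dx, abs_nonneg dy, mul_le_mul_of_nonneg_left hn₁ (abs_nonneg dy),
      mul_le_mul_of_nonneg_left hn₀ (abs_nonneg dx)]
  refine ⟨h4, ?_⟩
  have h5 : dy ^ 2 ≤ dx ^ 2 / 4 := by
    rw [← sq_abs dy, ← sq_abs dx]
    nlinarith [abs_nonneg dy]
  have h6 : dy - -n₀ / n₁ * dx = (dx * n₀ + dy * n₁) / n₁ := by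
    field_simp
    ring
  rw [h6, abs_div, div_le_iff₀ (abs_pos.2 hn₁0)]
  nlinarith [mul_le_mul_of_nonneg_left hn₁ (mul_nonneg hK (sq_nonneg dx)),
    mul_le_mul_of_nonneg_left h5 hK]

theorem abs_coord_le_norm (x : E2) (i : Fin 2) : |x i| ≤ ‖x‖ := PiLp.norm_apply_le x i

section StandardPosition

variable {S : Set E2} {K r : ℝ}

theorem exists_slope (hK : 0 ≤ K) (hr : 40 * (K * r) ≤ 1) (hS : HasTangentBalls K S)
    (h0 : (0 : E2) ∈ S) (hflat : ∀ s ∈ S, |s 1| ≤ K * ‖s‖ ^ 2) {s : E2} (hs : s ∈ S)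
    (hsr : ‖s‖ < r) :
    ∃ m : ℝ, ∀ s' ∈ S, ‖s'‖ < r → |s' 1 - s 1| ≤ |s' 0 - s 0| / 2 ∧
      |s' 1 - s 1 - m * (s' 0 - s 0)| ≤ 2 * K * (s' 0 - s 0) ^ 2 := by
  have hν : ∃ ν : E2, ν 0 ^ 2 + ν 1 ^ 2 = 1 ∧ |ν 0| ≤ 1 / 10 ∧
      ∀ s' ∈ S, |inner ℝ (s' - s) ν| ≤ K * ‖s' - s‖ ^ 2 := by
    rcases eq_or_ne s 0 with rfl | hne
    · refine ⟨pt 0 1, by simp, by simp, fun s' hs' => ?_⟩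
      rw [inner_eq]
      simpa using hflat s' hs'
    · obtain ⟨ν, hν1, hν⟩ := hS s hs
      have hn : ν 0 ^ 2 + ν 1 ^ 2 = 1 := by rw [← norm_sq_eq, hν1, one_pow]
      refine ⟨ν, hn, ?_, hν⟩
      have h1 := hν 0 h0
      rw [zero_sub, inner_neg_left, abs_neg, norm_neg, inner_eq, norm_sq_eq] at h1
      have h2 := hflat s hs
      rw [norm_sq_eq] at h2
      have hx := (abs_coord_le_norm s 0).trans hsr.le
      have hy := (abs_coord_le_norm s 1).trans hsr.le
      have h3 : K * s 0 ^ 2 ≤ |s 0| / 40 := by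
        rw [← sq_abs]
        nlinarith [abs_nonneg (s 0), mul_le_mul_of_nonneg_left hx hK]
      have h4 : K * s 1 ^ 2 ≤ |s 1| / 40 := by
        rw [← sq_abs]
        nlinarith [abs_nonneg (s 1), mul_le_mul_of_nonneg_left hy hK]
      have hx0 : 0 < |s 0| := by
        rw [abs_pos]
        intro h
        rw [h] at h2 h3
        have : s 1 = 0 := by
          rw [← abs_nonpos_iff]
          norm_num at h2 h3
          linarith [abs_nonneg (s 1)]
        exact hne (ext_coords h this)
      have h5 : |s 0| * |ν 0| ≤ |s 0 * ν 0 + s 1 * ν 1| + |s 1| * |ν 1| := by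
        rw [← abs_mul, ← abs_mul]
        have := abs_sub (s 0 * ν 0 + s 1 * ν 1) (s 1 * ν 1)
        rwa [add_sub_cancel_right] at this
      have h6 : |ν 1| ≤ 1 := by
        have := abs_coord_le_norm ν 1
        rwa [hν1] at this
      have h7 : |s 0| * |ν 0| ≤ |s 0| * (1 / 10) := by
        nlinarith [mul_le_mul_of_nonneg_left h6 (abs_nonneg (s 1))]
      exact le_of_mul_le_mul_left h7 hx0
  obtain ⟨ν, hn, hn₀, hν⟩ := hν
  refine ⟨-(ν 0) / ν 1, fun s' hs' hs'r => ?_⟩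
  have hlt : ‖s' - s‖ ≤ 2 * r := (norm_sub_le _ _).trans (by linarith)
  have h1 := hν s' hs'
  rw [inner_eq, norm_sq_eq] at h1
  exact slope_estimate hK hr hn hn₀ ((abs_coord_le_norm (s' - s) 0).trans hlt)
    ((abs_coord_le_norm (s' - s) 1).trans hlt) h1

theorem oneSided_of_isPreconnected {c : ℝ} (hc : 2 * c < r)
    (hcone : ∀ s ∈ S, ‖s‖ < r → |s 1| ≤ |s 0| / 2) (hpre : IsPreconnected S)
    {q : E2} (hq : q ∈ S) (hqr : r ≤ ‖q‖) {t : ℝ}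
    (ht : t ∈ (fun s : E2 => s 0) '' (S ∩ ball 0 r)) (htc : |t| < c) :
    Ico t c ⊆ (fun s : E2 => s 0) '' (S ∩ ball 0 r) ∨
      Ioc (-c) t ⊆ (fun s : E2 => s 0) '' (S ∩ ball 0 r) := by
  by_contra! hcon
  obtain ⟨⟨b, hb, hbT⟩, ⟨a, ha, haT⟩⟩ := And.imp not_subset.1 not_subset.1 hcon
  obtain ⟨s₀, hs₀, rfl⟩ := ht
  have hat : a < s₀ 0 := lt_of_le_of_ne ha.2 fun h => haT ⟨s₀, hs₀, h.symm⟩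
  have hbt : s₀ 0 < b := lt_of_le_of_ne hb.1 fun h => hbT ⟨s₀, hs₀, h⟩
  have hcont : Continuous fun s : E2 => s 0 := by fun_prop
  obtain ⟨s, hsS, hsu, hsv⟩ := hpre
    (ball 0 r ∩ (fun s : E2 => s 0) ⁻¹' Ioo a b)
    (closedBall 0 (2 * c) ∩ (fun s : E2 => s 0) ⁻¹' Icc a b)ᶜ
    (isOpen_ball.inter (isOpen_Ioo.preimage hcont))
    (isClosed_closedBall.inter (isClosed_Icc.preimage hcont)).isOpen_compl
    (fun s hs => by
      by_contra hcon
      simp only [mem_union, mem_compl_iff, not_or, not_not] at hcon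
      obtain ⟨hu, hball, hIcc⟩ := hcon
      have hsr : s ∈ ball (0 : E2) r := closedBall_subset_ball hc hball
      refine hu ⟨hsr, lt_of_le_of_ne hIcc.1 fun h => haT ⟨s, ⟨hs, hsr⟩, h.symm⟩,
        lt_of_le_of_ne hIcc.2 fun h => hbT ⟨s, ⟨hs, hsr⟩, h⟩⟩)
    ⟨s₀, hs₀.1, hs₀.2, hat, hbt⟩
    ⟨q, hq, fun h => by
      have := mem_closedBall_zero_iff.1 h.1
      linarith⟩
  refine hsv ⟨?_, hsu.2.1.le, hsu.2.2.le⟩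
  rw [mem_closedBall_zero_iff]
  have h1 := hcone s hsS (mem_ball_zero_iff.1 hsu.1)
  have h2 : |s 0| ≤ c := abs_le.2 ⟨by have := hsu.2.1; linarith [ha.1],
    by have := hsu.2.2; linarith [hb.2]⟩
  have hc0 : 0 ≤ c := (abs_nonneg _).trans h2
  refine abs_le_of_sq_le_sq' ?_ (by positivity) |>.2
  rw [norm_sq_eq, ← sq_abs (s 0), ← sq_abs (s 1)]
  nlinarith [abs_nonneg (s 0), abs_nonneg (s 1)]

theorem isC11GraphAt_zero_of_Ico (hK : 0 ≤ K) {c : ℝ} (hc : 0 < c) (hr0 : 0 < r)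
    (hr : 40 * (K * r) ≤ 1) (hS : HasTangentBalls K S) (h0 : (0 : E2) ∈ S)
    (hflat : ∀ s ∈ S, |s 1| ≤ K * ‖s‖ ^ 2)
    (hside : ∀ t ∈ (fun s : E2 => s 0) '' (S ∩ ball 0 r), |t| < c →
      Ico t c ⊆ (fun s : E2 => s 0) '' (S ∩ ball 0 r) ∨
        Ioc (-c) t ⊆ (fun s : E2 => s 0) '' (S ∩ ball 0 r))
    (hright : Ico 0 c ⊆ (fun s : E2 => s 0) '' (S ∩ ball 0 r)) : IsC11GraphAt S 0 := by
  set T := (fun s : E2 => s 0) '' (S ∩ ball 0 r)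
  obtain ⟨a, ha, hI⟩ := inter_Ioo_eq_of_oneSided hc hright hside
  have hcvx : Convex ℝ (T ∩ Ioo a c) := by
    rcases hI with h | h <;> rw [h]
    exacts [convex_Ioo _ _, convex_Ico _ _]
  have hσ : ∀ t : ℝ, ∃ s : E2, t ∈ T → (s ∈ S ∧ ‖s‖ < r) ∧ s 0 = t := by
    intro t
    by_cases ht : t ∈ T
    · obtain ⟨s, hs, hst⟩ := ht
      exact ⟨s, fun _ => ⟨⟨hs.1, mem_ball_zero_iff.1 hs.2⟩, hst⟩⟩
    · exact ⟨0, fun h => absurd h ht⟩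
  choose σ hσ using hσ
  have hm : ∀ t : ℝ, ∃ m : ℝ, t ∈ T → ∀ s' ∈ S, ‖s'‖ < r →
      |s' 1 - σ t 1| ≤ |s' 0 - t| / 2 ∧
      |s' 1 - σ t 1 - m * (s' 0 - t)| ≤ 2 * K * (s' 0 - t) ^ 2 := by
    intro t
    by_cases ht : t ∈ T
    · obtain ⟨⟨h1, h2⟩, h3⟩ := hσ t ht
      obtain ⟨m, hm⟩ := exists_slope hK hr hS h0 hflat h1 h2
      rw [h3] at hm
      exact ⟨m, fun _ => hm⟩
    · exact ⟨0, fun h => absurd h ht⟩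
  choose m hm using hm
  obtain ⟨g, hg, hgL, hfg⟩ := exists_contDiff_of_quadratic_approx hcvx
    (f := fun t => σ t 1) (m := m) (C := 2 * K) (by positivity) (by
      intro t ht t' ht'
      obtain ⟨⟨h1, h2⟩, h3⟩ := hσ t' ht'.1
      have := (hm t ht.1 _ h1 h2).2
      rwa [h3] at this)
  refine ⟨AffineIsometryEquiv.refl ℝ E2, ball 0 r ∩ (fun s : E2 => s 0) ⁻¹' Ioo a c, g,
    T ∩ Ioo a c, isOpen_ball.inter (isOpen_Ioo.preimage (by fun_prop)),
    ⟨mem_ball_self hr0, by simpa using ⟨ha, hc⟩⟩,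
    hI.imp (fun h => ⟨a, c, ha.trans hc, h⟩) (fun h => ⟨0, c, hc, h⟩), hg, hgL, ?_⟩
  rw [AffineIsometryEquiv.coe_refl, image_id]
  ext s
  constructor
  · rintro ⟨hsS, hsr, hsI⟩
    have hsT : s 0 ∈ T := ⟨s, ⟨hsS, hsr⟩, rfl⟩
    refine ⟨s 0, ⟨hsT, hsI⟩, ext_coords (by simp) ?_⟩
    have h1 := (hm _ hsT s hsS (mem_ball_zero_iff.1 hsr)).1
    rw [sub_self, abs_zero, zero_div, abs_nonpos_iff, sub_eq_zero] at h1
    rw [pt_one, h1]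
    exact (hfg ⟨hsT, hsI⟩).symm
  · rintro ⟨t, ht, rfl⟩
    obtain ⟨⟨h1, h2⟩, h3⟩ := hσ t ht.1
    have : pt t (g t) = σ t :=
      ext_coords (by simp [h3]) (by rw [pt_one]; exact (hfg ht).symm)
    simp only [this]
    exact ⟨h1, mem_ball_zero_iff.2 h2, by rw [mem_preimage, h3]; exact ht.2⟩

theorem IsC11GraphAt.of_image {p : E2} (e : E2 ≃ᵃⁱ[ℝ] E2) (h : IsC11GraphAt (e '' S) (e p)) :
    IsC11GraphAt S p := by
  obtain ⟨e₁, U, g, I, hU, hp, hI, hg, hgL, heq⟩ := h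
  refine ⟨e.trans e₁, e ⁻¹' U, g, I, hU.preimage e.continuous, hp, hI, hg, hgL, ?_⟩
  rw [← heq, ← image_inter_preimage, AffineIsometryEquiv.coe_trans, image_comp]

theorem HasTangentBalls.image (hS : HasTangentBalls K S) (e : E2 ≃ᵃⁱ[ℝ] E2) :
    HasTangentBalls K (e '' S) := by
  rintro _ ⟨s, hs, rfl⟩
  obtain ⟨ν, hν, h⟩ := hS s hs
  refine ⟨e.linearIsometryEquiv ν, by rw [LinearIsometryEquiv.norm_map, hν], ?_⟩
  rintro _ ⟨s', hs', rfl⟩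
  rw [← vsub_eq_sub, ← e.map_vsub, LinearIsometryEquiv.inner_map_map,
    LinearIsometryEquiv.norm_map]
  exact h s' hs'

theorem isC11GraphAt_zero (hK : 0 < K) (hS : HasTangentBalls K S) (h0 : (0 : E2) ∈ S)
    (hflat : ∀ s ∈ S, |s 1| ≤ K * ‖s‖ ^ 2) (hpre : IsPreconnected S) (hnt : S.Nontrivial) :
    IsC11GraphAt S 0 := by
  obtain ⟨q, hq, hq0⟩ := hnt.exists_ne 0
  have hqpos : 0 < ‖q‖ := norm_pos_iff.2 hq0
  obtain ⟨r, hr0, hr, hqr⟩ : ∃ r : ℝ, 0 < r ∧ 40 * (K * r) ≤ 1 ∧ r ≤ ‖q‖ := by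
    refine ⟨min (1 / (40 * K)) ‖q‖, by positivity, ?_, min_le_right _ _⟩
    have := (le_div_iff₀ (by positivity)).1 (min_le_left (1 / (40 * K)) ‖q‖)
    linarith
  have hcone : ∀ s ∈ S, ‖s‖ < r → |s 1| ≤ |s 0| / 2 := by
    intro s hs hsr
    obtain ⟨m, hm⟩ := exists_slope hK.le hr hS h0 hflat h0 (by simpa using hr0)
    simpa using (hm s hs hsr).1
  have hc : 0 < r / 3 := by positivity
  have hc2 : 2 * (r / 3) < r := by linarith
  have h0T : (0 : ℝ) ∈ (fun s : E2 => s 0) '' (S ∩ ball 0 r) :=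
    ⟨0, ⟨h0, mem_ball_self hr0⟩, by simp⟩
  rcases oneSided_of_isPreconnected hc2 hcone hpre hq hqr h0T (by simpa using hc) with h | h
  · exact isC11GraphAt_zero_of_Ico hK.le hc hr0 hr hS h0 hflat
      (fun t ht htc => oneSided_of_isPreconnected hc2 hcone hpre hq hqr ht htc) h
  · set e : E2 ≃ᵃⁱ[ℝ] E2 := (LinearIsometryEquiv.neg ℝ).toAffineIsometryEquiv
    have he : ∀ s, e s = -s := fun s => rfl
    refine IsC11GraphAt.of_image e ?_
    rw [he, neg_zero]
    have h0' : (0 : E2) ∈ e '' S := ⟨0, h0, by rw [he, neg_zero]⟩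
    refine isC11GraphAt_zero_of_Ico hK.le hc hr0 hr (hS.image e) h0' ?_
      (fun t ht htc => oneSided_of_isPreconnected hc2 ?_
        (hpre.image e e.continuous.continuousOn) (q := e q) ⟨q, hq, rfl⟩
        (by rwa [he, norm_neg]) ht htc) ?_
    · rintro _ ⟨s, hs, rfl⟩
      simpa [he] using hflat s hs
    · rintro _ ⟨s, hs, rfl⟩ hsr
      rw [he, norm_neg] at hsr
      simpa [he] using hcone s hs hsr
    · intro t ht
      obtain ⟨s, hs, hst⟩ := h (show -t ∈ Ioc (-(r / 3)) 0 from
        ⟨neg_lt_neg ht.2, neg_nonpos.2 ht.1⟩)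
      refine ⟨e s, ⟨⟨s, hs.1, rfl⟩, ?_⟩, ?_⟩
      · rw [mem_ball_zero_iff, he, norm_neg]
        exact mem_ball_zero_iff.1 hs.2
      · have : s 0 = -t := hst
        simp [he, this]

end StandardPosition

theorem exists_affineIsometryEquiv_coords (p ν : E2) (hν : ‖ν‖ = 1) :
    ∃ e : E2 ≃ᵃⁱ[ℝ] E2, e p = 0 ∧ ∀ s, e s 1 = inner ℝ (s - p) ν := by
  have hν2 : ν 0 ^ 2 + ν 1 ^ 2 = 1 := by rw [← norm_sq_eq, hν, one_pow]
  let f : E2 →ₗ[ℝ] E2 :=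
    { toFun := fun x => pt (x 0 * ν 1 - x 1 * ν 0) (x 0 * ν 0 + x 1 * ν 1)
      map_add' := fun x y => ext_coords (by simp; ring) (by simp; ring)
      map_smul' := fun a x => ext_coords (by simp; ring) (by simp; ring) }
  have hf : ∀ x y, inner ℝ (f x) (f y) = inner ℝ x y := by
    intro x y
    rw [inner_eq, inner_eq]
    change pt _ _ 0 * pt _ _ 0 + pt _ _ 1 * pt _ _ 1 = _
    simp only [pt_zero, pt_one]
    linear_combination (x 0 * y 0 + x 1 * y 1) * hν2
  refine ⟨(AffineIsometryEquiv.constVAdd ℝ E2 (-p)).trans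
    ((f.isometryOfInner hf).toLinearIsometryEquiv rfl).toAffineIsometryEquiv, ?_, fun s => ?_⟩
  · simp
  · rw [inner_eq]
    change f (-p + s) 1 = _
    change pt _ _ 1 = _
    simp only [pt_one, PiLp.add_apply, PiLp.neg_apply, PiLp.sub_apply]
    ring

theorem HasTangentBalls.isC11GraphAt {S : Set E2} {K : ℝ} (hK : 0 < K)
    (hS : HasTangentBalls K S) (hpre : IsPreconnected S) (hnt : S.Nontrivial) {p : E2}
    (hp : p ∈ S) : IsC11GraphAt S p := by
  obtain ⟨ν, hν, h⟩ := hS p hp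
  obtain ⟨e, hep, he⟩ := exists_affineIsometryEquiv_coords p ν hν
  refine IsC11GraphAt.of_image e ?_
  rw [hep]
  refine isC11GraphAt_zero hK (hS.image e) ⟨p, hp, hep⟩ ?_
    (hpre.image e e.continuous.continuousOn) (hnt.image e.injective)
  rintro _ ⟨s, hs, rfl⟩
  have : ‖e s‖ = ‖s - p‖ := by
    rw [← dist_eq_norm, ← e.dist_map, hep, dist_zero_right]
  rw [he, this]
  exact h s hs

/-- **Theorem.** Let `Ω ⊂ ℝ²` be a nonempty open bounded connected domain whose high ridge
and cut locus coincide, `S := H(Ω) = Cut(Ω)`. Then `S` is either a singleton or a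
`1`-dimensional manifold of class `C^{1,1}` (possibly with boundary), and `Ω` is the open
`ρ_Ω`-tubular neighborhood of `S`, where `ρ_Ω := max_{closure Ω} d_{∂Ω}`. -/
theorem stmt4 (Ω : Set E2) (hne : Ω.Nonempty) (hop : IsOpen Ω)
    (hbd : Bornology.IsBounded Ω) (hconn : IsConnected Ω)
    (S : Set E2) (hS : S = highRidge Ω) (hScut : highRidge Ω = cutLocus Ω) :
    ((∃ p, S = {p}) ∨ (∀ p ∈ S, IsC11GraphAt S p)) ∧
    Ω = {x | infDist x S < inradius Ω} := by
  subst hS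
  have hsk : skeleton Ω ⊆ highRidge Ω := hScut ▸ subset_closure
  refine ⟨?_, eq_tubularNeighborhood hne hop hbd hsk⟩
  rcases (highRidge Ω).subsingleton_or_nontrivial with hsub | hnt
  · obtain ⟨p, hp⟩ := highRidge_nonempty hne hbd
    exact Or.inl ⟨p, hsub.eq_singleton_of_mem hp⟩
  · have hρ := inradius_pos hne hop hbd
    exact Or.inr fun p hp => (hasTangentBalls_highRidge hop hbd hconn hsk hnt).isC11GraphAt
      (by positivity) (isPreconnected_highRidge hop hbd hconn hsk) hnt hp
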